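/- arXiv:0807.1676 — 3 statements merged into one kernel-verified Lean document; each statement's English description precedes it below -/
import Mathlib

section
/- Let M ≥ 1 and n ≥ 1, and let T_0, T_1, …, T_n be the spacing partial sums for the alternating word A_n = (1,0,1,0,…) of length n. Then A_n is M-seen in Y if and only if T_k ≤ kM for all 1 ≤ k ≤ n and T_k − T_j < (k − j + 1)M for all 0 ≤ j < k ≤ n. -/
open MeasureTheory ProbabilityTheory

/-- `m` is an `M`-admissible embedding of the word `w` (of length `n`, letters `w 1, …, w n`)
in the sequence `Y` (letters `Y 1, Y 2, …`). -/
def AdmEmbFin (M n : ℕ) (w : ℕ → Bool) (Y : ℕ → Bool) (m : ℕ → ℕ) : Prop :=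
  m 0 = 0 ∧ ∀ i, 1 ≤ i → i ≤ n → m (i - 1) < m i ∧ m i - m (i - 1) ≤ M ∧ Y (m i) = w i

/-- The finite word `w` (of length `n`) is `M`-seen in the sequence `Y`. -/
def MSeenFin (M n : ℕ) (w : ℕ → Bool) (Y : ℕ → Bool) : Prop :=
  ∃ m : ℕ → ℕ, AdmEmbFin M n w Y m

/-- The alternating word `1,0,1,0,…` (indexed from `1`). -/
def altWord : ℕ → Bool := fun i => i % 2 == 1

/-- The spacing partial sums of the word `w` in the sequence `Y`:
`T 0 = 0` and `T (k+1) = min {i > T k : Y i = w (k+1)}`. -/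
noncomputable def spacingT (w Y : ℕ → Bool) : ℕ → ℕ
  | 0 => 0
  | k + 1 => sInf {i | spacingT w Y k < i ∧ Y i = w (k + 1)}

section Spacing

variable {w Y : ℕ → Bool}

lemma altWord_succ (k : ℕ) : altWord (k + 1) = !altWord k := by
  simp only [altWord]
  rcases Nat.mod_two_eq_zero_or_one k with h | h <;> simp [Nat.add_mod, h]

lemma spacingT_succ_spec (hY : ∀ (b : Bool) (N : ℕ), ∃ i, N < i ∧ Y i = b) (k : ℕ) :
    spacingT w Y k < spacingT w Y (k + 1) ∧ Y (spacingT w Y (k + 1)) = w (k + 1) :=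
  Nat.sInf_mem (s := {i | spacingT w Y k < i ∧ Y i = w (k + 1)}) (hY _ _)

lemma spacingT_succ_le {k p : ℕ} (hp : spacingT w Y k < p) (hYp : Y p = w (k + 1)) :
    spacingT w Y (k + 1) ≤ p :=
  Nat.sInf_le (s := {i | spacingT w Y k < i ∧ Y i = w (k + 1)}) ⟨hp, hYp⟩

lemma spacingT_strictMono (hY : ∀ (b : Bool) (N : ℕ), ∃ i, N < i ∧ Y i = b) :
    StrictMono (spacingT w Y) :=
  strictMono_nat_of_lt_succ fun k => (spacingT_succ_spec hY k).1

/-- `Y` is constant, equal to `altWord k`, from `T k` up to `T (k + 1)`. -/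
lemma eq_altWord_of_mem_run (hY : ∀ (b : Bool) (N : ℕ), ∃ i, N < i ∧ Y i = b) {k p : ℕ}
    (hk : 1 ≤ k) (hp : spacingT altWord Y k ≤ p) (hp' : p < spacingT altWord Y (k + 1)) :
    Y p = altWord k := by
  rcases hp.eq_or_lt with rfl | hlt
  · obtain ⟨k, rfl⟩ := Nat.exists_eq_add_of_le' hk
    exact (spacingT_succ_spec hY k).2
  · by_contra hne
    refine hp'.not_ge (spacingT_succ_le hlt ?_)
    rw [altWord_succ]
    cases h : Y p <;> cases h' : altWord k <;> simp_all

variable {M n : ℕ} {m : ℕ → ℕ}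

lemma AdmEmbFin.spacingT_le (h : AdmEmbFin M n w Y m) {k : ℕ} (hk : k ≤ n) :
    spacingT w Y k ≤ m k := by
  induction k with
  | zero => simp [spacingT]
  | succ k ih =>
    obtain ⟨h1, -, h3⟩ := h.2 (k + 1) (by omega) hk
    exact spacingT_succ_le ((ih (by omega)).trans_lt h1) h3

lemma AdmEmbFin.le_mul (h : AdmEmbFin M n w Y m) {k : ℕ} (hk : k ≤ n) : m k ≤ k * M := by
  induction k with
  | zero => simp [h.1]
  | succ k ih =>
    have h2 := (h.2 (k + 1) (by omega) hk).2.1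
    have := ih (by omega)
    rw [Nat.add_sub_cancel] at h2
    rw [Nat.succ_mul]
    omega

/-- An admissible embedding of the alternating word uses each run at most once, so after
entering `[T j, ∞)` it reaches `[T (j + d), ∞)` within `d` further steps. -/
lemma AdmEmbFin.exists_spacingT_le (hY : ∀ (b : Bool) (N : ℕ), ∃ i, N < i ∧ Y i = b)
    (h : AdmEmbFin M n altWord Y m) {j : ℕ} (hj : 1 ≤ j) (d : ℕ) (hd : j + d ≤ n) :
    ∃ i ≤ j + d, 1 ≤ i ∧ spacingT altWord Y (j + d) ≤ m i ∧
      m i < spacingT altWord Y j + (d + 1) * M := by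
  induction d with
  | zero =>
    have hex : ∃ i, spacingT altWord Y j ≤ m i := ⟨j, h.spacingT_le hd⟩
    classical
    have hle : Nat.find hex ≤ j := Nat.find_min' hex (h.spacingT_le hd)
    have hpos : 1 ≤ Nat.find hex := by
      rw [Nat.one_le_iff_ne_zero]
      intro h0
      have hspec := Nat.find_spec hex
      have hlt := spacingT_strictMono (w := altWord) hY (show 0 < j from hj)
      rw [h0, h.1] at hspec
      omega
    have hmin := Nat.find_min hex (m := Nat.find hex - 1) (by omega)
    have hstep := (h.2 _ hpos (hle.trans hd)).2.1
    exact ⟨Nat.find hex, hle, hpos, Nat.find_spec hex, by omega⟩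
  | succ d ih =>
    obtain ⟨i, hi, hi1, hlo, hhi⟩ := ih (by omega)
    rw [Nat.succ_mul (d + 1)]
    by_cases hc : spacingT altWord Y (j + d + 1) ≤ m i
    · exact ⟨i, by omega, hi1, hc, by omega⟩
    · obtain ⟨h1, h2, h3⟩ := h.2 (i + 1) (by omega) (by omega)
      rw [Nat.add_sub_cancel] at h1 h2
      refine ⟨i + 1, by omega, by omega, spacingT_succ_le (hlo.trans_lt h1) ?_, by omega⟩
      rw [h3, altWord_succ, altWord_succ, ← (h.2 i hi1 (by omega)).2.2,
        eq_altWord_of_mem_run hY (by omega) hlo (by omega)]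
      rfl

/-- The embedding using every run in turn, each time stepping as far as the bound `M` and the
end of the run allow. -/
noncomputable def runEmb (M : ℕ) (Y : ℕ → Bool) : ℕ → ℕ
  | 0 => 0
  | i + 1 => min (runEmb M Y i + M) (spacingT altWord Y (i + 2) - 1)

lemma runEmb_eq (M : ℕ) (Y : ℕ → Bool) (i : ℕ) :
    runEmb M Y i = i * M ∨ ∃ j d, 1 ≤ j ∧ j + d = i + 1 ∧
      runEmb M Y i = spacingT altWord Y j - 1 + d * M := by
  induction i with
  | zero => simp [runEmb]
  | succ i ih =>
    rw [runEmb]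
    rcases min_choice (runEmb M Y i + M) (spacingT altWord Y (i + 2) - 1) with h | h <;> rw [h]
    · rcases ih with ih | ⟨j, d, hj, hd, ih⟩ <;> rw [ih]
      · exact Or.inl (Nat.succ_mul i M).symm
      · exact Or.inr ⟨j, d + 1, hj, by omega, by rw [Nat.succ_mul]; omega⟩
    · exact Or.inr ⟨i + 2, 0, by omega, by omega, by simp⟩

lemma spacingT_le_runEmb (hY : ∀ (b : Bool) (N : ℕ), ∃ i, N < i ∧ Y i = b)
    (hT : ∀ k, 1 ≤ k → k ≤ n → spacingT altWord Y k ≤ k * M)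
    (hT' : ∀ j k, j < k → k ≤ n →
      spacingT altWord Y k - spacingT altWord Y j < (k - j + 1) * M)
    {i : ℕ} (hi : i ≤ n) : spacingT altWord Y i ≤ runEmb M Y i := by
  rcases Nat.eq_zero_or_pos i with rfl | hi0
  · simp [spacingT]
  rcases runEmb_eq M Y i with h | ⟨j, d, hj, hd, h⟩ <;> rw [h]
  · exact hT i hi0 hi
  · have hmono := spacingT_strictMono (w := altWord) hY
    have hpos := hmono (show 0 < j from hj)
    rcases lt_trichotomy j i with hji | rfl | hji
    · have := hT' j i hji hi
      rw [show i - j + 1 = d by omega] at this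
      omega
    · obtain rfl : d = 1 := by omega
      have : 1 ≤ M := by
        by_contra hM
        have := hT j hj hi
        obtain rfl : M = 0 := by omega
        omega
      omega
    · have := hmono hji
      omega

end Spacing

/-- the alternating word `A n` is `M`-seen in `Y` if and only if `T k ≤ k M` for
all `1 ≤ k ≤ n` and `T k - T j < (k - j + 1) M` for all `0 ≤ j < k ≤ n`.  (The hypothesis `hY`,
which holds almost surely for a Bernoulli sequence, guarantees that both letters occur
infinitely often in `Y`, so that the spacing variables are well defined.) -/
theorem statement4 (M n : ℕ) (hM : 1 ≤ M) (hn : 1 ≤ n) (Y : ℕ → Bool)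
    (hY : ∀ (b : Bool) (N : ℕ), ∃ i, N < i ∧ Y i = b) :
    MSeenFin M n altWord Y ↔
      ((∀ k, 1 ≤ k → k ≤ n → spacingT altWord Y k ≤ k * M) ∧
        ∀ j k, j < k → k ≤ n →
          spacingT altWord Y k - spacingT altWord Y j < (k - j + 1) * M) := by
  constructor
  · rintro ⟨m, hm⟩
    refine ⟨fun k _ hk => (hm.spacingT_le hk).trans (hm.le_mul hk), fun j k hjk hk => ?_⟩
    rcases Nat.eq_zero_or_pos j with rfl | hj
    · have := (hm.spacingT_le hk).trans (hm.le_mul hk)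
      rw [Nat.sub_zero, Nat.succ_mul]
      omega
    · obtain ⟨d, rfl⟩ := Nat.exists_eq_add_of_le hjk.le
      obtain ⟨i, -, -, hlo, hhi⟩ := hm.exists_spacingT_le hY hj d hk
      rw [Nat.add_sub_cancel_left]
      have := spacingT_strictMono (w := altWord) hY hjk
      omega
  · rintro ⟨hT, hT'⟩
    refine ⟨runEmb M Y, rfl, fun i hi hin => ?_⟩
    obtain ⟨i, rfl⟩ := Nat.exists_eq_add_of_le' hi
    have hlo := spacingT_le_runEmb hY hT hT' hin
    have hmono := spacingT_strictMono (w := altWord) hY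
    have hpos := hmono (show i + 1 < i + 2 by omega)
    have hstep : runEmb M Y (i + 1) ≤ runEmb M Y i + M := min_le_left _ _
    have hend : runEmb M Y (i + 1) ≤ spacingT altWord Y (i + 2) - 1 := min_le_right _ _
    have hprev : runEmb M Y i < spacingT altWord Y (i + 1) := by
      have hlt := hmono (show 0 < i + 1 by omega)
      cases i with
      | zero => exact hlt
      | succ i =>
        exact (min_le_right _ _).trans_lt (Nat.sub_one_lt_of_lt hlt)
    rw [Nat.add_sub_cancel]
    exact ⟨by omega, by omega, eq_altWord_of_mem_run hY hi hlo (by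
      change _ < spacingT altWord Y (i + 2)
      omega)⟩
end

section
/- Let M ≥ 2 be an integer, α = 1 − 2^{−M}, β = 2^{−M}, and let f(λ) = λ² − (α + (M−1)β)λ + β(M − 2α). Then f has two real roots, one lying in the open interval (0, Mβ) and the other in the open interval (α, 1). -/
/-- An exponential bound for `n + 1`, valid from `n = 2` on. -/
lemma add_one_lt_two_pow {n : ℕ} (hn : 2 ≤ n) : n + 1 < 2 ^ n := by
  induction n, hn using Nat.le_induction with
  | base => norm_num
  | succ k hk ih => rw [pow_succ]; omega

/-- for an integer `M ≥ 2`, with `α = 1 - 2^{-M}` and `β = 2^{-M}`, the quadratic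
`f(λ) = λ² - (α + (M-1)β) λ + β (M - 2α)` has exactly two real roots, one in the open interval
`(0, M β)` and the other in the open interval `(α, 1)`. -/
theorem statement9 (M : ℕ) (hM : 2 ≤ M) (α β : ℝ)
    (hα : α = 1 - (1 / 2 : ℝ) ^ M) (hβ : β = (1 / 2 : ℝ) ^ M) :
    ∃ x y : ℝ, x ∈ Set.Ioo 0 ((M : ℝ) * β) ∧ y ∈ Set.Ioo α 1 ∧
      ∀ z : ℝ, z ^ 2 - (α + ((M : ℝ) - 1) * β) * z + β * ((M : ℝ) - 2 * α) = 0 ↔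
        (z = x ∨ z = y) := by
  have hβ0 : 0 < β := by rw [hβ]; positivity
  have hM2 : (2 : ℝ) ≤ M := by exact_mod_cast hM
  have hlt : ((M : ℝ) + 1) * β < 1 := by
    have h : ((M : ℝ) + 1) < 2 ^ M := by exact_mod_cast add_one_lt_two_pow hM
    rw [hβ, one_div, inv_pow, ← div_eq_mul_inv, div_lt_one (by positivity)]
    exact h
  obtain rfl : α = 1 - β := by rw [hα, hβ]
  set f : ℝ → ℝ := fun z =>
    z ^ 2 - (1 - β + ((M : ℝ) - 1) * β) * z + β * ((M : ℝ) - 2 * (1 - β)) with hf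
  have hcont : Continuous f := by fun_prop
  have hneg : β * (((M : ℝ) + 1) * β - 1) < 0 := mul_neg_of_pos_of_neg hβ0 (by linarith)
  have hf0 : 0 < f 0 := by
    have : f 0 = β * ((M : ℝ) - 2 + 2 * β) := by simp only [hf]; ring
    rw [this]
    exact mul_pos hβ0 (by linarith)
  have hfMβ : f (M * β) < 0 := by
    have : f (M * β) = 2 * (β * (((M : ℝ) + 1) * β - 1)) := by simp only [hf]; ring
    linarith
  have hfα : f (1 - β) < 0 := by
    have : f (1 - β) = β * (((M : ℝ) + 1) * β - 1) := by simp only [hf]; ring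
    linarith
  have hf1 : 0 < f 1 := by
    have : f 1 = 2 * β ^ 2 := by simp only [hf]; ring
    rw [this]
    positivity
  obtain ⟨x, hx, hfx⟩ := intermediate_value_Ioo' (by positivity) hcont.continuousOn
    (show (0 : ℝ) ∈ Set.Ioo (f (M * β)) (f 0) from ⟨hfMβ, hf0⟩)
  obtain ⟨y, hy, hfy⟩ := intermediate_value_Ioo (by linarith) hcont.continuousOn
    (show (0 : ℝ) ∈ Set.Ioo (f (1 - β)) (f 1) from ⟨hfα, hf1⟩)
  have hxy : x - y ≠ 0 := by
    have h1 := hx.2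
    have h2 := hy.1
    exact ne_of_lt (by linarith)
  simp only [hf] at hfx hfy
  have hsum : x + y = 1 - β + ((M : ℝ) - 1) * β :=
    mul_left_cancel₀ hxy (by linear_combination hfx - hfy)
  refine ⟨x, y, hx, hy, fun z => ?_⟩
  have hfactor : z ^ 2 - (1 - β + ((M : ℝ) - 1) * β) * z + β * ((M : ℝ) - 2 * (1 - β)) =
      (z - x) * (z - y) := by
    linear_combination hfx + (z - x) * hsum
  rw [hfactor, mul_eq_zero, sub_eq_zero, sub_eq_zero]
end

section
/- Let W = (w_1, …, w_n) be a binary word that is seen in Y at positions (m_1, …, m_n) with m_0 = 0 and 0 < m_{i+1} − m_i ≤ M for each i. If w_k ≠ w_{k+1} = w_{k+2} = … = w_l for some indices with k + 1 ≤ l, and if τ_l > M, then T_l ≤ m_{k+1}. -/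
/-- Any occurrence of `w (k + 1)` in `Y` after `T k` is at or after `T (k + 1)`. -/
theorem spacingT_succ_le_s12 {w Y : ℕ → Bool} {k i : ℕ} (hi : spacingT w Y k < i)
    (hYi : Y i = w (k + 1)) : spacingT w Y (k + 1) ≤ i :=
  Nat.sInf_le ⟨hi, hYi⟩

/-- The greedy positions `T i` are dominated by any positions at which the word is seen. -/
theorem spacingT_le_of_seen {n : ℕ} {w Y : ℕ → Bool} {m : ℕ → ℕ}
    (hmono : ∀ i, i < n → m i < m (i + 1))
    (hseen : ∀ i, 1 ≤ i → i ≤ n → Y (m i) = w i) :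
    ∀ i, i ≤ n → spacingT w Y i ≤ m i := by
  intro i
  induction i with
  | zero => intro _; simp [spacingT]
  | succ i ih =>
    intro hi
    exact spacingT_succ_le_s12 ((ih (by omega)).trans_lt (hmono i (by omega)))
      (hseen (i + 1) (by omega) hi)

/-- suppose the word `w` of length `n` is seen in `Y` at positions
`m 1 < ⋯ < m n` with `m 0 = 0` and `0 < m (i+1) - m i ≤ M` for each `i`.  If
`w k ≠ w (k+1) = ⋯ = w l` for some `1 ≤ k < k + 1 ≤ l ≤ n`, and if `τ l = T l - T (l-1) > M`,
then `T l ≤ m (k+1)`.  (The hypothesis `hY`, which holds almost surely for a Bernoulli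
sequence, guarantees that the spacing variables are well defined.) -/
theorem statement12 (M n : ℕ) (hM : 1 ≤ M) (w Y : ℕ → Bool)
    (hY : ∀ (b : Bool) (N : ℕ), ∃ i, N < i ∧ Y i = b)
    (m : ℕ → ℕ) (hm0 : m 0 = 0)
    (hgap : ∀ i, i < n → m i < m (i + 1) ∧ m (i + 1) - m i ≤ M)
    (hseen : ∀ i, 1 ≤ i → i ≤ n → Y (m i) = w i)
    (k l : ℕ) (hk : 1 ≤ k) (hkl : k + 1 ≤ l) (hln : l ≤ n)
    (hne : w k ≠ w (k + 1))
    (hconst : ∀ i, k + 1 ≤ i → i ≤ l → w i = w (k + 1))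
    (hτ : M < spacingT w Y l - spacingT w Y (l - 1)) :
    spacingT w Y l ≤ m (k + 1) := by
  by_contra! hlt
  obtain ⟨p, rfl⟩ : ∃ p, l = p + 1 := ⟨l - 1, by omega⟩
  rw [Nat.add_sub_cancel] at hτ
  have hbefore : ∀ j, k + 1 ≤ j → j ≤ p + 1 → m j < spacingT w Y (p + 1) := by
    intro j hj
    induction j, hj using Nat.le_induction with
    | base => exact fun _ => hlt
    | succ j hj ih =>
      intro hjl
      have hmj := ih (by omega)
      have hle : m j ≤ spacingT w Y p := by
        by_contra! hgt
        have hYj : Y (m j) = w (p + 1) := by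
          rw [hseen j (by omega) (by omega), hconst j hj (by omega),
            hconst (p + 1) hkl le_rfl]
        exact absurd (spacingT_succ_le_s12 hgt hYj) (by omega)
      have := hgap j (by omega)
      omega
  exact absurd (spacingT_le_of_seen (fun i hi => (hgap i hi).1) hseen (p + 1) hln)
    (not_le.mpr (hbefore (p + 1) hkl le_rfl))
end
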